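/- arXiv:2205.02292 — 5 statements merged into one kernel-verified Lean document; each statement's English description precedes it below -/
import Mathlib

section
/- Let K be a field complete with respect to a nontrivial discretely valued nonarchimedean absolute value, and let M and N be ultrametric K-Banach spaces whose norms take values in |K| ∪ {0}. Then every surjective continuous K-linear map f : M → N admits a continuous K-linear section s : N → M with f ∘ s = id_N. (This is the analytic content of the paper's Lemma that every surjection of finite modules over an affinoid K-algebra admits a continuous K-linear section.) -/
/-- If the nonzero norms of a normed group are integer powers of some `r < 1`,
then every point outside the closure of a subgroup has a nearest point in that subgroup. -/
theorem AddSubgroup.exists_forall_norm_sub_le_of_zpow {N : Type*} [NormedAddCommGroup N] {r : ℝ}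
    (hr0 : 0 < r) (hr1 : r < 1) (hN : ∀ x : N, x ≠ 0 → ∃ n : ℤ, ‖x‖ = r ^ n)
    (D : AddSubgroup N) {y : N} (hy : y ∉ _root_.closure (D : Set N)) :
    ∃ z ∈ D, ∀ w ∈ D, ‖y - z‖ ≤ ‖y - w‖ := by
  have hpow : ∀ w ∈ D, ∃ n : ℤ, ‖y - w‖ = r ^ n := fun w hw ↦
    hN _ (sub_ne_zero.2 fun h ↦ hy (h ▸ _root_.subset_closure hw))
  obtain ⟨δ, hδ, hδy⟩ : ∃ δ > 0, ∀ w ∈ D, δ ≤ ‖y - w‖ := by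
    simpa [Metric.mem_closure_iff, dist_eq_norm] using hy
  obtain ⟨k, hk⟩ := exists_pow_lt_of_lt_one hδ hr1
  obtain ⟨n, ⟨z, hz, hzn⟩, hmax⟩ :=
    Int.exists_greatest_of_bdd (P := fun n ↦ ∃ w ∈ D, ‖y - w‖ = r ^ n)
      ⟨k, fun n ⟨w, hw, hwn⟩ ↦ by
        have : r ^ (k : ℤ) < r ^ n := by
          rw [zpow_natCast, ← hwn]
          exact hk.trans_le (hδy w hw)
        exact ((zpow_lt_zpow_iff_right_of_lt_one₀ hr0 hr1).1 this).le⟩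
      ((hpow 0 D.zero_mem).imp fun n hn ↦ ⟨0, D.zero_mem, hn⟩)
  refine ⟨z, hz, fun w hw ↦ ?_⟩
  obtain ⟨m, hm⟩ := hpow w hw
  rw [hzn, hm]
  exact (zpow_le_zpow_iff_right_of_lt_one₀ hr0 hr1).2 (hmax m ⟨w, hw, hm⟩)

section BoundedSection

variable {K M N : Type*} [NontriviallyNormedField K]
  [NormedAddCommGroup M] [NormedSpace K M] [NormedAddCommGroup N] [NormedSpace K N]

/-- A partially defined linear section of `f` whose norm is bounded by `C`. -/
def LinearPMap.IsBoundedSection (f : M →L[K] N) (C : ℝ) (s : N →ₗ.[K] M) : Prop :=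
  ∀ x : s.domain, f (s x) = x ∧ ‖s x‖ ≤ C * ‖(x : N)‖

theorem LinearPMap.exists_maximal_isBoundedSection (f : M →L[K] N) (C : ℝ) :
    ∃ s : N →ₗ.[K] M, Maximal (IsBoundedSection f C) s := by
  have hbot : IsBoundedSection f C ⊥ := by
    rintro ⟨x, hx⟩
    have hx0 : x = 0 := hx
    subst hx0
    have h0 : (⊥ : N →ₗ.[K] M) ⟨0, hx⟩ = 0 := (⊥ : N →ₗ.[K] M).map_zero
    simp [h0]
  have hchain : ∀ c ⊆ {s : N →ₗ.[K] M | IsBoundedSection f C s}, IsChain (· ≤ ·) c →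
      ∀ t ∈ c, ∃ ub ∈ {s : N →ₗ.[K] M | IsBoundedSection f C s}, ∀ l ∈ c, l ≤ ub := by
    intro c hcs hc t ht
    refine ⟨LinearPMap.sSup c hc.directedOn, ?_, fun _ ↦ LinearPMap.le_sSup hc.directedOn⟩
    rintro ⟨x, hx⟩
    obtain ⟨l, hl, hxl⟩ := (mem_domain_sSup_iff ⟨t, ht⟩ hc.directedOn).1 hx
    rw [LinearPMap.sSup_apply hc.directedOn hl ⟨x, hxl⟩]
    exact hcs hl ⟨x, hxl⟩
  obtain ⟨s, -, hs⟩ := zorn_le_nonempty₀ _ hchain ⊥ hbot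
  exact ⟨s, hs⟩

/-- In an ultrametric setting, a bounded section extends along a vector orthogonal to its
domain. -/
theorem LinearPMap.IsBoundedSection.supSpanSingleton {f : M →L[K] N} {C : ℝ} (hC : 0 ≤ C)
    (hMu : ∀ x y : M, ‖x + y‖ ≤ max ‖x‖ ‖y‖) (hNu : ∀ x y : N, ‖x + y‖ ≤ max ‖x‖ ‖y‖)
    {s : N →ₗ.[K] M} (hs : s.IsBoundedSection f C) {e : N} {m : M} (he : e ∉ s.domain)
    (horth : ∀ w ∈ s.domain, ‖e‖ ≤ ‖e - w‖) (hme : f m = e) (hm : ‖m‖ ≤ C * ‖e‖) :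
    (s.supSpanSingleton e m he).IsBoundedSection f C := by
  rintro ⟨x, hx⟩
  obtain ⟨w, hw, u, hu, rfl⟩ := Submodule.mem_sup.1 hx
  obtain ⟨a, rfl⟩ := Submodule.mem_span_singleton.1 hu
  rw [LinearPMap.supSpanSingleton_apply_mk s e m he w hw a]
  have hae : ‖a • e‖ ≤ ‖w + a • e‖ := by
    rcases eq_or_ne a 0 with rfl | ha
    · simp
    have h := horth (-(a⁻¹ • w)) (s.domain.neg_mem (s.domain.smul_mem _ hw))
    have heq : w + a • e = a • (e - -(a⁻¹ • w)) := by
      simp [smul_add, smul_smul, ha, add_comm]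
    rw [heq, norm_smul, norm_smul]
    gcongr
  have hwe : ‖w‖ ≤ ‖w + a • e‖ := by
    simpa [hae] using hNu (w + a • e) (-(a • e))
  refine ⟨by simp [(hs ⟨w, hw⟩).1, hme], (hMu _ _).trans (max_le ?_ ?_)⟩
  · exact (hs ⟨w, hw⟩).2.trans (mul_le_mul_of_nonneg_left hwe hC)
  · calc ‖a • m‖ = ‖a‖ * ‖m‖ := norm_smul _ _
      _ ≤ ‖a‖ * (C * ‖e‖) := by gcongr
      _ = C * ‖a • e‖ := by rw [norm_smul]; ring
      _ ≤ C * ‖w + a • e‖ := mul_le_mul_of_nonneg_left hae hC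

end BoundedSection


/-- Over a field `K` complete with respect to a nontrivial discretely valued nonarchimedean
absolute value, every surjective continuous `K`-linear map between ultrametric `K`-Banach
spaces whose norms take values in `|K| ∪ {0}` admits a continuous `K`-linear section. -/
theorem stmt0 {K : Type*} [NontriviallyNormedField K] [CompleteSpace K]
    (hKu : ∀ x y : K, ‖x + y‖ ≤ max ‖x‖ ‖y‖)
    (ϖ : K) (hϖ0 : 0 < ‖ϖ‖) (hϖ1 : ‖ϖ‖ < 1)
    (hdisc : ∀ x : K, x ≠ 0 → ∃ z : ℤ, ‖x‖ = ‖ϖ‖ ^ z)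
    {M : Type*} [NormedAddCommGroup M] [NormedSpace K M] [CompleteSpace M]
    (hMu : ∀ x y : M, ‖x + y‖ ≤ max ‖x‖ ‖y‖)
    (hMv : ∀ x : M, ∃ a : K, ‖x‖ = ‖a‖)
    {N : Type*} [NormedAddCommGroup N] [NormedSpace K N] [CompleteSpace N]
    (hNu : ∀ x y : N, ‖x + y‖ ≤ max ‖x‖ ‖y‖)
    (hNv : ∀ x : N, ∃ a : K, ‖x‖ = ‖a‖)
    (f : M →L[K] N) (hf : Function.Surjective f) :
    ∃ s : N →L[K] M, ∀ y : N, f (s y) = y := by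
  obtain ⟨C, hC, hpre⟩ := f.exists_preimage_norm_le hf
  obtain ⟨s, hs, hmax⟩ := LinearPMap.exists_maximal_isBoundedSection f C
  have hN : ∀ x : N, x ≠ 0 → ∃ n : ℤ, ‖x‖ = ‖ϖ‖ ^ n := fun x hx ↦ by
    obtain ⟨a, ha⟩ := hNv x
    rw [ha]
    exact hdisc a (norm_ne_zero_iff.1 (ha ▸ norm_ne_zero_iff.2 hx))
  have hdense : DenseRange s.domain.subtype := by
    intro y
    by_contra hy
    replace hy : y ∉ closure (s.domain.toAddSubgroup : Set N) := by
      simpa using hy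
    obtain ⟨z, hz, hzmin⟩ :=
      s.domain.toAddSubgroup.exists_forall_norm_sub_le_of_zpow hϖ0 hϖ1 hN hy
    have he : y - z ∉ s.domain := fun h ↦
      hy (subset_closure (by simpa using s.domain.add_mem h hz))
    obtain ⟨m, hme, hm⟩ := hpre (y - z)
    have hext := hs.supSpanSingleton hC.le hMu hNu he
      (fun w hw ↦ by simpa [sub_sub] using hzmin (z + w) (s.domain.add_mem hz hw)) hme hm
    refine he ((hmax hext (LinearPMap.left_le_sup _ _ _)).1 ?_)
    exact Submodule.mem_sup_right (Submodule.mem_span_singleton_self _)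
  refine ⟨s.toFun.extendOfNorm s.domain.subtype, fun y ↦ ?_⟩
  refine hdense.induction_on y (isClosed_eq (by fun_prop) continuous_id) fun x ↦ ?_
  rw [LinearMap.extendOfNorm_eq hdense ⟨C, fun x ↦ (hs x).2⟩]
  exact (hs x).1
end

section
/- Let K be a field complete with respect to a nontrivial discretely valued nonarchimedean absolute value, and let N be an ultrametric K-Banach space whose norm takes values in |K| ∪ {0}. Then there exist a set T and a surjective K-linear isometry from c₀(T; K) onto N, where c₀(T; K) denotes the space of all functions a : T → K such that {t ∈ T : |a(t)| ≥ ε} is finite for every ε > 0, equipped with the supremum norm ‖a‖ = sup_{t∈T} |a(t)|. (This structure theorem is what the paper proves by lifting a basis of N°/ϖN° and using ϖ-adic completeness of the unit ball N°.) -/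
open scoped ENNReal

/-- The space `c₀(T; K)` of functions `a : T → K` such that `{t | ‖a t‖ ≥ ε}` is finite for
every `ε > 0`, realised as a submodule of `ℓ^∞(T; K)` (so that it carries the supremum
norm `‖a‖ = ⨆ t, ‖a t‖`). -/
noncomputable def c0Space (T : Type*) (K : Type*) [NormedField K] :
    Submodule K (lp (fun _ : T => K) ∞) where
  carrier := {a | ∀ ε : ℝ, 0 < ε → {t : T | ε ≤ ‖(a : ∀ _ : T, K) t‖}.Finite}
  zero_mem' := by
    intro ε hε
    refine Set.finite_empty.subset ?_
    intro t ht
    simp only [Set.mem_setOf_eq, lp.coeFn_zero, Pi.zero_apply, norm_zero] at ht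
    exact absurd ht (not_le.mpr hε)
  add_mem' := by
    intro a b ha hb ε hε
    refine ((ha (ε / 2) (by linarith)).union (hb (ε / 2) (by linarith))).subset ?_
    intro t ht
    simp only [Set.mem_setOf_eq, lp.coeFn_add, Pi.add_apply] at ht
    by_contra hc
    simp only [Set.mem_union, Set.mem_setOf_eq, not_or, not_le] at hc
    have h1 := norm_add_le ((a : ∀ _ : T, K) t) ((b : ∀ _ : T, K) t)
    linarith [hc.1, hc.2]
  smul_mem' := by
    intro c a ha ε hε
    rcases eq_or_ne c 0 with rfl | hc
    · refine Set.finite_empty.subset ?_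
      intro t ht
      simp only [Set.mem_setOf_eq, zero_smul, lp.coeFn_zero, Pi.zero_apply, norm_zero] at ht
      exact absurd ht (not_le.mpr hε)
    · refine (ha (ε / ‖c‖) (div_pos hε (norm_pos_iff.mpr hc))).subset ?_
      intro t ht
      simp only [Set.mem_setOf_eq, lp.coeFn_smul, Pi.smul_apply, norm_smul] at ht
      rw [Set.mem_setOf_eq, div_le_iff₀ (norm_pos_iff.mpr hc), mul_comm]
      exact ht

universe u

open Filter Topology

/-- A set of unit vectors which is norm-orthogonal: the norm of each coefficient of a finite
linear combination is bounded by the norm of the combination. -/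
def IsNormOrthonormal (K : Type*) {N : Type*} [NormedField K] [NormedAddCommGroup N]
    [NormedSpace K N] (S : Set N) : Prop :=
  (∀ x ∈ S, ‖x‖ = 1) ∧
    ∀ s : Finset N, (s : Set N) ⊆ S → ∀ (c : N → K), ∀ t ∈ s, ‖c t‖ ≤ ‖∑ x ∈ s, c x • x‖

section

variable {K : Type*} {N : Type*} [NormedField K] [NormedAddCommGroup N] [NormedSpace K N]

lemma IsNormOrthonormal.empty : IsNormOrthonormal K (∅ : Set N) := by
  refine ⟨by simp, fun s hs c t ht => ?_⟩
  exact absurd (hs ht) (Set.notMem_empty t)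

lemma IsNormOrthonormal.mono {S S' : Set N} (h : IsNormOrthonormal K S) (hS : S' ⊆ S) :
    IsNormOrthonormal K S' :=
  ⟨fun x hx => h.1 x (hS hx), fun s hs => h.2 s (hs.trans hS)⟩

lemma exists_maximal_isNormOrthonormal :
    ∃ S : Set N, Maximal (IsNormOrthonormal K) S := by
  have hF : Order.IsOfFiniteCharacter {S : Set N | IsNormOrthonormal K S} := by
    refine fun S => ⟨fun h y hy _ => h.mono hy, fun h => ⟨fun x hx => ?_, fun s hs => ?_⟩⟩
    · exact (h {x} (by simpa using hx) (Set.finite_singleton x)).1 x rfl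
    · exact (h s hs s.finite_toSet).2 s subset_rfl
  obtain ⟨S, -, hS⟩ := hF.exists_maximal IsNormOrthonormal.empty
  exact ⟨S, hS⟩

lemma IsNormOrthonormal.norm_le_norm_sum {S : Set N} (h : IsNormOrthonormal K S)
    (s : Finset S) (a : S → K) {t : S} (ht : t ∈ s) :
    ‖a t‖ ≤ ‖∑ x ∈ s, a x • (x : N)‖ := by
  classical
  have := h.2 (s.map (Function.Embedding.subtype _)) (by simp)
    (fun x => if hx : x ∈ S then a ⟨x, hx⟩ else 0) t (by simpa using ht)
  simpa [Finset.sum_map] using this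

/-- A unit vector at distance at least `1` from the span can be adjoined. -/
lemma IsNormOrthonormal.insert [IsUltrametricDist N] {S : Set N} (h : IsNormOrthonormal K S)
    {x : N} (hx : ‖x‖ = 1) (hd : ∀ y ∈ Submodule.span K S, 1 ≤ ‖x - y‖) :
    IsNormOrthonormal K (insert x S) := by
  classical
  refine ⟨?_, fun s hs c t ht => ?_⟩
  · rintro y (rfl | hy)
    exacts [hx, h.1 y hy]
  have hsub : ((s.erase x : Finset N) : Set N) ⊆ S := by
    intro y hy
    rw [Finset.mem_coe, Finset.mem_erase] at hy
    exact (hs hy.2).resolve_left hy.1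
  by_cases hxs : x ∈ s
  · rw [← Finset.add_sum_erase s _ hxs]
    set y := ∑ z ∈ s.erase x, c z • z with hy
    have hyS : y ∈ Submodule.span K S :=
      Submodule.sum_mem _ fun z hz => Submodule.smul_mem _ _ (Submodule.subset_span (hsub hz))
    have hcx : ‖c x‖ ≤ ‖c x • x + y‖ := by
      rcases eq_or_ne (c x) 0 with h0 | h0
      · simp [h0]
      · have := hd (-((c x)⁻¹ • y)) (Submodule.neg_mem _ (Submodule.smul_mem _ _ hyS))
        have heq : c x • x + y = c x • (x - -((c x)⁻¹ • y)) := by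
          rw [sub_neg_eq_add, smul_add, smul_inv_smul₀ h0]
        rw [heq, norm_smul]
        exact le_mul_of_one_le_right (norm_nonneg _) this
    rcases eq_or_ne t x with rfl | htx
    · exact hcx
    · refine (h.2 _ hsub c t (Finset.mem_erase.2 ⟨htx, ht⟩)).trans ?_
      have hmax := IsUltrametricDist.norm_add_le_max (c x • x + y) (-(c x • x))
      rw [add_neg_cancel_comm, norm_neg, norm_smul, hx, mul_one, max_eq_left hcx] at hmax
      exact hmax
  · rw [Finset.erase_eq_of_notMem hxs] at hsub
    exact h.2 s hsub c t ht

lemma isClosed_c0Space (T : Type*) : IsClosed (c0Space T K : Set (lp (fun _ : T => K) ∞)) := by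
  refine isClosed_of_closure_subset fun a ha ε hε => ?_
  obtain ⟨b, hb, hab⟩ := Metric.mem_closure_iff.1 ha (ε / 2) (half_pos hε)
  refine (hb (ε / 2) (half_pos hε)).subset fun t ht => ?_
  have h1 := lp.norm_apply_le_norm ENNReal.top_ne_zero (a - b) t
  rw [← dist_eq_norm, lp.coeFn_sub, Pi.sub_apply] at h1
  have h2 := norm_sub_norm_le ((a : ∀ _ : T, K) t) ((b : ∀ _ : T, K) t)
  simp only [Set.mem_ofPred_eq] at ht ⊢
  linarith

lemma c0Space.summable_smul {T : Type*} [IsUltrametricDist N] [CompleteSpace N]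
    (a : c0Space T K) {v : T → N} (hv : ∀ t, ‖v t‖ = 1) :
    Summable fun t => (a : lp (fun _ : T => K) ∞) t • v t := by
  refine NonarchimedeanAddGroup.summable_of_tendsto_cofinite_zero ?_
  rw [Metric.tendsto_nhds]
  intro ε hε
  rw [eventually_cofinite]
  simpa [norm_smul, hv] using a.2 ε hε

/-- The linear map `a ↦ ∑ a t • v t` attached to a family of unit vectors `v`. -/
noncomputable def c0Space.sumSMul {T : Type*} [IsUltrametricDist N] [CompleteSpace N]
    {v : T → N} (hv : ∀ t, ‖v t‖ = 1) : c0Space T K →ₗ[K] N where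
  toFun a := ∑' t, (a : lp (fun _ : T => K) ∞) t • v t
  map_add' a b := by
    rw [← (summable_smul a hv).tsum_add (summable_smul b hv)]
    simp [add_smul]
  map_smul' c a := by
    rw [RingHom.id_apply, ← (summable_smul a hv).tsum_const_smul c]
    simp [mul_smul]

lemma c0Space.mem_range_sumSMul {T : Type*} [IsUltrametricDist N] [CompleteSpace N]
    {v : T → N} (hv : ∀ t, ‖v t‖ = 1) (t : T) :
    v t ∈ LinearMap.range (sumSMul (K := K) hv) := by
  classical
  refine ⟨⟨lp.single ∞ t (1 : K), fun ε hε => (Set.finite_singleton t).subset fun u hu => ?_⟩, ?_⟩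
  · by_contra hut
    rw [Set.mem_ofPred_eq, lp.single_apply_ne _ _ _ hut, norm_zero] at hu
    exact hu.not_gt hε
  · refine (tsum_eq_single t fun u hu => ?_).trans ?_
    · simp [Pi.single_eq_of_ne hu]
    · simp

lemma IsNormOrthonormal.isometry_sumSMul [IsUltrametricDist N] [CompleteSpace N] {S : Set N}
    (h : IsNormOrthonormal K S) :
    Isometry (c0Space.sumSMul (K := K) (v := ((↑) : S → N)) fun t => h.1 t t.2) := by
  refine AddMonoidHomClass.isometry_of_norm _ fun a => ?_
  have hs := (c0Space.summable_smul a (v := ((↑) : S → N)) fun t => h.1 t t.2).hasSum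
  refine le_antisymm ?_ ?_
  · refine le_of_tendsto hs.norm (Eventually.of_forall fun s => ?_)
    refine IsUltrametricDist.norm_sum_le_of_forall_le_of_nonneg (norm_nonneg _) fun t _ => ?_
    rw [norm_smul, h.1 t t.2, mul_one]
    exact lp.norm_apply_le_norm ENNReal.top_ne_zero _ t
  · refine lp.norm_le_of_forall_le (norm_nonneg _) fun t => ?_
    refine ge_of_tendsto hs.norm ?_
    filter_upwards [eventually_ge_atTop {t}] with s hts
    exact h.norm_le_norm_sum s _ (hts (Finset.mem_singleton_self t))

end

/-- Structure theorem: every ultrametric `K`-Banach space with norm values in `|K| ∪ {0}`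
over a complete nontrivially discretely valued nonarchimedean field `K` is the image of a
surjective `K`-linear isometry from some `c₀(T; K)`. -/
theorem stmt1 {K : Type*} [NontriviallyNormedField K] [CompleteSpace K]
    (hKu : ∀ x y : K, ‖x + y‖ ≤ max ‖x‖ ‖y‖)
    (ϖ : K) (hϖ0 : 0 < ‖ϖ‖) (hϖ1 : ‖ϖ‖ < 1)
    (hdisc : ∀ x : K, x ≠ 0 → ∃ z : ℤ, ‖x‖ = ‖ϖ‖ ^ z)
    {N : Type u} [NormedAddCommGroup N] [NormedSpace K N] [CompleteSpace N]
    (hNu : ∀ x y : N, ‖x + y‖ ≤ max ‖x‖ ‖y‖)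
    (hNv : ∀ x : N, ∃ a : K, ‖x‖ = ‖a‖) :
    ∃ (T : Type u) (f : ↥(c0Space T K) →ₗ[K] N), Isometry f ∧ Function.Surjective f := by
  have : IsUltrametricDist N :=
    IsUltrametricDist.isUltrametricDist_of_forall_norm_add_le_max_norm hNu
  have hone : ∀ x : N, ‖ϖ‖ < ‖x‖ → 1 ≤ ‖x‖ := by
    intro x hx
    obtain ⟨a, ha⟩ := hNv x
    obtain ⟨z, hz⟩ := hdisc a (norm_pos_iff.1 (ha ▸ hϖ0.trans hx))
    rw [ha, hz] at hx ⊢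
    have hz1 : z < 1 := (zpow_lt_zpow_iff_right_of_lt_one₀ hϖ0 hϖ1).1 (by simpa using hx)
    exact one_le_zpow_of_nonpos₀ hϖ0 hϖ1.le (by omega)
  obtain ⟨S, hS⟩ := exists_maximal_isNormOrthonormal (K := K) (N := N)
  have hv : ∀ t : S, ‖(t : N)‖ = 1 := fun t => hS.prop.1 t t.2
  set f := c0Space.sumSMul (K := K) hv
  have hf : Isometry f := hS.prop.isometry_sumSMul
  refine ⟨S, f, hf, LinearMap.range_eq_top.1 ?_⟩
  have : CompleteSpace (c0Space S K) := (isClosed_c0Space S).completeSpace_coe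
  have hclosed : IsClosed (LinearMap.range f : Set N) := by
    rw [LinearMap.coe_range]
    exact hf.isClosedEmbedding.isClosed_range
  by_contra hne
  obtain ⟨r, hr, hr1⟩ := exists_between hϖ1
  obtain ⟨x, hxf, hx⟩ := riesz_lemma hclosed
    (not_forall.1 fun h => hne (Submodule.eq_top_iff'.2 h)) hr1
  have hx0 : x ≠ 0 := fun h => hxf (h ▸ Submodule.zero_mem _)
  obtain ⟨a, ha⟩ := hNv x
  have ha0 : a ≠ 0 := norm_pos_iff.1 (ha ▸ norm_pos_iff.2 hx0)
  have hunit : ‖a⁻¹ • x‖ = 1 := by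
    rw [norm_smul, norm_inv, ha, inv_mul_cancel₀ (norm_ne_zero_iff.2 ha0)]
  have hspan : Submodule.span K S ≤ LinearMap.range f :=
    Submodule.span_le.2 fun t ht => c0Space.mem_range_sumSMul hv ⟨t, ht⟩
  have hins : IsNormOrthonormal K (insert (a⁻¹ • x) S) := by
    refine hS.prop.insert hunit fun y hy => hone _ (hr.trans_le ?_)
    have h1 := hx (a • y) (Submodule.smul_mem _ _ (hspan hy))
    have h2 : x - a • y = a • (a⁻¹ • x - y) := by rw [smul_sub, smul_inv_smul₀ ha0]
    rw [h2, norm_smul, ha, mul_comm] at h1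
    exact le_of_mul_le_mul_left h1 (norm_pos_iff.2 ha0)
  have hmem : a⁻¹ • x ∈ S := hS.le_of_ge hins (Set.subset_insert _ _) (Set.mem_insert _ _)
  refine hxf ?_
  rw [← smul_inv_smul₀ ha0 x]
  exact Submodule.smul_mem _ _ (hspan (Submodule.subset_span hmem))
end

section
/- Let K be a field with a nontrivial discretely valued nonarchimedean absolute value, let M be an ultrametric normed K-vector space whose norm takes values in |K| ∪ {0}, and let L ⊆ M be a closed K-linear subspace. Then for every x ∈ M the distance from x to L is attained: there exists l ∈ L with ‖x − l‖ = inf_{l'∈L} ‖x − l'‖; moreover this infimum again lies in |K| ∪ {0}. (In particular the quotient norm on M/L takes values in |K| ∪ {0}.) -/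
/-- Over a field `K` with a nontrivial discretely valued nonarchimedean absolute value, if `M`
is an ultrametric normed `K`-vector space with norm values in `|K| ∪ {0}` and `L ⊆ M` is a
closed `K`-linear subspace, then for every `x ∈ M` the distance from `x` to `L` is attained,
and this distance again lies in `|K| ∪ {0}`. -/
theorem stmt4 {K : Type*} [NontriviallyNormedField K]
    (hKu : ∀ x y : K, ‖x + y‖ ≤ max ‖x‖ ‖y‖)
    (ϖ : K) (hϖ0 : 0 < ‖ϖ‖) (hϖ1 : ‖ϖ‖ < 1)
    (hdisc : ∀ x : K, x ≠ 0 → ∃ z : ℤ, ‖x‖ = ‖ϖ‖ ^ z)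
    {M : Type*} [NormedAddCommGroup M] [NormedSpace K M]
    (hMu : ∀ x y : M, ‖x + y‖ ≤ max ‖x‖ ‖y‖)
    (hMv : ∀ x : M, ∃ a : K, ‖x‖ = ‖a‖)
    (L : Submodule K M) (hL : IsClosed (L : Set M)) (x : M) :
    (∃ l ∈ L, ‖x - l‖ = Metric.infDist x (L : Set M)) ∧
      ∃ a : K, Metric.infDist x (L : Set M) = ‖a‖ := by
  have hne : (L : Set M).Nonempty := ⟨0, L.zero_mem⟩
  have hmin : ∃ l ∈ L, ‖x - l‖ = Metric.infDist x (L : Set M) := by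
    rcases (Metric.infDist_nonneg (x := x) (s := (L : Set M))).eq_or_lt with h0 | hpos
    · exact ⟨x, (hL.mem_iff_infDist_zero hne).2 h0.symm, by simpa using h0⟩
    · have hy : 1 < ‖ϖ‖⁻¹ := (one_lt_inv₀ hϖ0).2 hϖ1
      obtain ⟨n, hn, hn'⟩ := exists_mem_Ico_zpow hpos hy
      obtain ⟨l, hl, hlt⟩ := (Metric.infDist_lt_iff hne).1 hn'
      have hle := Metric.infDist_le_dist_of_mem (x := x) hl
      rw [dist_eq_norm] at hlt hle
      refine ⟨l, hl, le_antisymm ?_ hle⟩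
      obtain ⟨a, ha⟩ := hMv (x - l)
      obtain ⟨z, hz⟩ := hdisc a (norm_pos_iff.1 (ha ▸ hpos.trans_le hle))
      have hnorm : ‖x - l‖ = ‖ϖ‖⁻¹ ^ (-z) := by rw [ha, hz, inv_zpow, zpow_neg, inv_inv]
      rw [hnorm] at hlt ⊢
      have hzn : -z < n + 1 := (zpow_lt_zpow_iff_right₀ hy).1 hlt
      exact ((zpow_le_zpow_iff_right₀ hy).2 (Int.lt_add_one_iff.1 hzn)).trans hn
  obtain ⟨l, hl, hxl⟩ := hmin
  exact ⟨⟨l, hl, hxl⟩, hxl ▸ hMv (x - l)⟩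
end

section
/- Let A be a commutative ring with a ℤ-grading A = ⊕_{d∈ℤ} A_d. Let I ⊆ A be the ideal generated by all homogeneous elements of nonzero degree, and for m ≥ 0 let J_m ⊆ A be the ideal generated by all homogeneous elements whose degree d satisfies |d| > m. Then I^{2n+1} ⊆ J_n for every n ≥ 0. (This is the inclusion (𝒲_{≠0})^{2n+1} ⊆ (𝒲_{<−n}, 𝒲_{>n}) established in the paper's proof that the weight-truncation and (𝒲_{≠0})-adic filtrations on a weighted dg algebra are equivalent.) -/
/-- In degree `m + n + 1`, every binomial term of `(I ⊔ J) ^ (m + n + 1)` has a factor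
`I ^ (m + 1)` or a factor `J ^ (n + 1)`. -/
theorem sup_pow_add_add_one_le {R : Type*} [CommSemiring R] (I J : Ideal R) (m n : ℕ) :
    (I ⊔ J) ^ (m + n + 1) ≤ I ^ (m + 1) ⊔ J ^ (n + 1) := by
  rw [← Ideal.add_eq_sup, ← Ideal.add_eq_sup, add_pow, Ideal.sum_eq_sup]
  refine Finset.sup_le fun i _ => Ideal.mul_le_left.trans ?_
  obtain h | h := le_or_gt (m + 1) i
  · exact Ideal.mul_le_left.trans ((Ideal.pow_le_pow_right h).trans le_sup_left)
  · refine Ideal.mul_le_right.trans ((Ideal.pow_le_pow_right ?_).trans le_sup_right)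
    omega

/-- With `ε = ±1`, products of `k` homogeneous elements of positive (resp. negative) degree have
degree at least `k` (resp. at most `-k`). -/
theorem span_pos_degree_pow_le {A : Type*} [CommRing A] (𝒜 : ℤ → AddSubgroup A) [GradedRing 𝒜]
    (ε : ℤ) (k : ℕ) :
    Ideal.span {x : A | ∃ d : ℤ, 0 < ε * d ∧ x ∈ 𝒜 d} ^ k ≤
      Ideal.span {x : A | ∃ d : ℤ, (k : ℤ) ≤ ε * d ∧ x ∈ 𝒜 d} := by
  induction k with
  | zero =>
    rw [pow_zero, Ideal.one_eq_top, top_le_iff, Ideal.eq_top_iff_one]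
    exact Ideal.subset_span ⟨0, by simp, SetLike.GradedOne.one_mem⟩
  | succ k ih =>
    rw [pow_succ]
    refine (Ideal.mul_mono_left ih).trans ?_
    rw [Ideal.span_mul_span', Ideal.span_le]
    rintro _ ⟨x, ⟨d, hd, hx⟩, y, ⟨e, he, hy⟩, rfl⟩
    refine Ideal.subset_span ⟨d + e, ?_, SetLike.GradedMul.mul_mem hx hy⟩
    rw [mul_add]
    push_cast
    omega


/-- Let `A` be a commutative ring with a `ℤ`-grading.  Let `I` be the ideal generated by all
homogeneous elements of nonzero degree, and for `m ≥ 0` let `J_m` be the ideal generated by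
all homogeneous elements whose degree `d` satisfies `|d| > m`.  Then
`I ^ (2n + 1) ⊆ J_n` for every `n ≥ 0`. -/
theorem stmt9 {A : Type*} [CommRing A] (𝒜 : ℤ → AddSubgroup A) [GradedRing 𝒜] (n : ℕ) :
    Ideal.span {x : A | ∃ d : ℤ, d ≠ 0 ∧ x ∈ 𝒜 d} ^ (2 * n + 1) ≤
      Ideal.span {x : A | ∃ d : ℤ, (n : ℤ) < |d| ∧ x ∈ 𝒜 d} := by
  have hsub : Ideal.span {x : A | ∃ d : ℤ, d ≠ 0 ∧ x ∈ 𝒜 d} ≤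
      Ideal.span {x : A | ∃ d : ℤ, 0 < 1 * d ∧ x ∈ 𝒜 d} ⊔
        Ideal.span {x : A | ∃ d : ℤ, 0 < -1 * d ∧ x ∈ 𝒜 d} := by
    rw [← Ideal.span_union]
    refine Ideal.span_mono ?_
    rintro x ⟨d, hd, hx⟩
    rcases lt_or_gt_of_ne hd with h | h
    · exact Or.inr ⟨d, by omega, hx⟩
    · exact Or.inl ⟨d, by omega, hx⟩
  refine (Ideal.pow_right_mono hsub _).trans ?_
  rw [two_mul]
  refine (sup_pow_add_add_one_le _ _ n n).trans (sup_le ?_ ?_)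
  all_goals
    refine (span_pos_degree_pow_le 𝒜 _ _).trans (Ideal.span_mono ?_)
    rintro x ⟨d, hd, hx⟩
    refine ⟨d, ?_, hx⟩
    rw [lt_abs]
    push_cast at hd
    omega
end

section
/- Let A be a commutative ring with a ℤ-grading A = ⊕_{d∈ℤ} A_d such that A_d = 0 whenever |d| > n, for some fixed n ≥ 0. Then the ideal I generated by all homogeneous elements of nonzero degree is nilpotent; more precisely I^{2n+1} = 0. In particular every homogeneous element of nonzero degree is nilpotent. (This is the paper's assertion that in a weighted algebra with bounded weights, all elements of the ideal generated by the nonzero-weight components are nilpotent.) -/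
open scoped Pointwise in
/-- If the graded pieces indexed by a sign `ε` vanish beyond `n`, then `n + 1` homogeneous elements
whose degrees have that sign multiply to zero. -/
theorem span_homogeneous_sign_pow_eq_bot {A : Type*} [CommRing A] (𝒜 : ℤ → AddSubgroup A)
    [SetLike.GradedMonoid 𝒜] (n : ℕ) (ε : ℤ) (h : ∀ d : ℤ, (n : ℤ) < ε * d → 𝒜 d = ⊥) :
    Ideal.span {x : A | ∃ d : ℤ, 0 < ε * d ∧ x ∈ 𝒜 d} ^ (n + 1) = ⊥ := by
  have mem_pow : ∀ (k : ℕ), ∀ x ∈ {x : A | ∃ d : ℤ, 0 < ε * d ∧ x ∈ 𝒜 d} ^ k,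
      ∃ d : ℤ, (k : ℤ) ≤ ε * d ∧ x ∈ 𝒜 d := by
    intro k
    induction k with
    | zero =>
      intro x hx
      rw [pow_zero, Set.mem_one] at hx
      exact ⟨0, by simp, hx ▸ SetLike.GradedOne.one_mem⟩
    | succ k ih =>
      intro x hx
      rw [pow_succ] at hx
      obtain ⟨a, ha, b, ⟨e, he, hb⟩, rfl⟩ := Set.mem_mul.1 hx
      obtain ⟨d, hd, ha⟩ := ih a ha
      exact ⟨d + e, by rw [mul_add]; push_cast; lia, SetLike.GradedMul.mul_mem ha hb⟩
  rw [Ideal.span, Submodule.span_pow, Submodule.span_eq_bot]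
  intro x hx
  obtain ⟨d, hd, hxd⟩ := mem_pow (n + 1) x hx
  rw [h d (by push_cast at hd; lia)] at hxd
  exact hxd

/-- Let `A` be a commutative ring with a `ℤ`-grading such that `A_d = 0` whenever `|d| > n`.
Then the ideal `I` generated by all homogeneous elements of nonzero degree is nilpotent, with
`I ^ (2n + 1) = 0`; in particular every homogeneous element of nonzero degree is nilpotent. -/
theorem stmt10 {A : Type*} [CommRing A] (𝒜 : ℤ → AddSubgroup A) [GradedRing 𝒜]
    (n : ℕ) (hbd : ∀ d : ℤ, (n : ℤ) < |d| → 𝒜 d = ⊥) :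
    Ideal.span {x : A | ∃ d : ℤ, d ≠ 0 ∧ x ∈ 𝒜 d} ^ (2 * n + 1) = ⊥ ∧
      ∀ d : ℤ, d ≠ 0 → ∀ x ∈ 𝒜 d, IsNilpotent x := by
  have hpow : Ideal.span {x : A | ∃ d : ℤ, d ≠ 0 ∧ x ∈ 𝒜 d} ^ (2 * n + 1) = ⊥ := by
    have hpos := span_homogeneous_sign_pow_eq_bot 𝒜 n 1
      fun d hd => hbd d (by grind)
    have hneg := span_homogeneous_sign_pow_eq_bot 𝒜 n (-1)
      fun d hd => hbd d (by grind)
    set P := Ideal.span {x : A | ∃ d : ℤ, 0 < 1 * d ∧ x ∈ 𝒜 d}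
    set N := Ideal.span {x : A | ∃ d : ℤ, 0 < -1 * d ∧ x ∈ 𝒜 d}
    have hle : Ideal.span {x : A | ∃ d : ℤ, d ≠ 0 ∧ x ∈ 𝒜 d} ≤ P + N := by
      refine Ideal.span_le.2 ?_
      rintro x ⟨d, hd, hx⟩
      rcases lt_or_gt_of_ne hd with hd | hd
      · exact Ideal.mem_sup_right (Ideal.subset_span ⟨d, by lia, hx⟩)
      · exact Ideal.mem_sup_left (Ideal.subset_span ⟨d, by lia, hx⟩)
    refine eq_bot_iff.2 ((Ideal.pow_right_mono hle _).trans (le_of_eq ?_))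
    rw [add_pow, ← Ideal.zero_eq_bot]
    refine Finset.sum_eq_zero fun m _ => ?_
    rcases le_or_gt (n + 1) m with hm | hm
    · rw [pow_eq_zero_of_le hm hpos, zero_mul, zero_mul]
    · rw [pow_eq_zero_of_le (by lia : n + 1 ≤ 2 * n + 1 - m) hneg, mul_zero, zero_mul]
  refine ⟨hpow, fun d hd x hx => ⟨2 * n + 1, ?_⟩⟩
  have hxI : x ∈ Ideal.span {x : A | ∃ d : ℤ, d ≠ 0 ∧ x ∈ 𝒜 d} :=
    Ideal.subset_span ⟨d, hd, hx⟩
  exact Ideal.mem_bot.1 (hpow ▸ Ideal.pow_mem_pow hxI (2 * n + 1))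
end
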